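/- Fix r ∈ ℓ↓ and λ ∈ (0,∞). For x ∈ ℓ↓ set x₀ := 1 and m(x) := inf{ i ∈ ℕ₀ : x_{i+1} < 1 }, and for j ∈ ℕ₀ define p_j(x) = λ − (λ − 1 + x_{j+2})^+ if j = m(x) − 1; p_j(x) = (λ − 1 + x_{j+1})^+ if j = m(x) and m(x) > 0; p_j(x) = λ if j = m(x) = 0; and p_j(x) = 0 otherwise. Then the system of integral equations ĝ_i(t) = r_i − ∫₀^t (ĝ_i(s) − ĝ_{i+1}(s)) ds + ∫₀^t p_{i−1}(ĝ(s)) ds, for all i ≥ 1 and t ≥ 0, has exactly one solution ĝ : [0,∞) → ℓ↓ that is continuous in the ℓ¹ norm. -/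

import Mathlib

open Filter Topology
open scoped NNReal

/-- `x ∈ ℓ↓`, where `x i` stands for the paper's coordinate `x_{i+1}`:
all coordinates lie in `[0,1]`, the sequence is non-increasing and summable. -/
def MemLdown (x : ℕ → ℝ) : Prop :=
  (∀ i, 0 ≤ x i ∧ x i ≤ 1) ∧ (∀ i, x (i + 1) ≤ x i) ∧ Summable x

/-- `m(x) = inf { i ∈ ℕ₀ : x_{i+1} < 1 }`; with the 0-based convention the paper's
`x_{i+1}` is `x i`. -/
noncomputable def mIdx (x : ℕ → ℝ) : ℕ := sInf {i : ℕ | x i < 1}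

/-- The coefficients `p_j(x)` of the explicit fluid-limit equations, `j ∈ ℕ₀`,
with the 0-based convention that the paper's `x_{i}` is `x (i-1)`. -/
noncomputable def pcoef (lam : ℝ) (x : ℕ → ℝ) (j : ℕ) : ℝ :=
  if j + 1 = mIdx x then lam - max (lam - 1 + x (j + 1)) 0
  else if j = mIdx x then (if j = 0 then lam else max (lam - 1 + x j) 0)
  else 0

open MeasureTheory Set

/-- The rate at which arrivals join a queue of length at least `j`; its discrete differences are
the coefficients `pcoef`. -/
noncomputable def overflow (lam : ℝ) (x : ℕ → ℝ) (j : ℕ) : ℝ :=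
  if j < mIdx x then lam
  else if j = mIdx x then (if j = 0 then lam else max (lam - 1 + x j) 0)
  else 0

theorem pcoef_eq_overflow_sub (lam : ℝ) (x : ℕ → ℝ) (j : ℕ) :
    pcoef lam x j = overflow lam x j - overflow lam x (j + 1) := by
  unfold pcoef overflow
  rcases lt_trichotomy (j + 1) (mIdx x) with h | h | h
  · have h1 : j + 1 ≠ mIdx x := h.ne
    have h2 : j ≠ mIdx x := by omega
    have h3 : j < mIdx x := by omega
    simp [h1, h2, h3, h]
  · have h3 : j < mIdx x := by omega
    have h4 : ¬ (j + 1 < mIdx x) := by omega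
    have h5 : mIdx x ≠ 0 := by omega
    simp [h, h3, h5]
  · have h1 : j + 1 ≠ mIdx x := h.ne'
    have h3 : ¬ j < mIdx x := by omega
    have h4 : ¬ (j + 1 < mIdx x) := by omega
    simp [h1, h3, h4]

theorem overflow_zero (lam : ℝ) (x : ℕ → ℝ) : overflow lam x 0 = lam := by
  unfold overflow
  split_ifs <;> first | rfl | omega

theorem overflow_nonneg {lam : ℝ} (hlam : 0 ≤ lam) (x : ℕ → ℝ) (j : ℕ) :
    0 ≤ overflow lam x j := by
  unfold overflow
  split_ifs <;> first | exact hlam | exact le_max_right _ _ | exact le_rfl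

theorem overflow_le {lam : ℝ} (hlam : 0 ≤ lam) {x : ℕ → ℝ} (hx : ∀ i, x i ≤ 1) (j : ℕ) :
    overflow lam x j ≤ lam := by
  unfold overflow
  have := hx j
  split_ifs <;> first | exact le_rfl | exact hlam | exact max_le (by linarith) hlam

theorem overflow_succ_eq_zero (lam : ℝ) {x : ℕ → ℝ} {j : ℕ} (hx : x j < 1) :
    overflow lam x (j + 1) = 0 := by
  have : mIdx x ≤ j := Nat.sInf_le hx
  unfold overflow
  rw [if_neg (by omega), if_neg (by omega)]

theorem MemLdown.tendsto_zero {x : ℕ → ℝ} (hx : MemLdown x) : Tendsto x atTop (𝓝 0) :=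
  hx.2.2.tendsto_atTop_zero

theorem MemLdown.exists_lt_one {x : ℕ → ℝ} (hx : MemLdown x) : ∃ i, x i < 1 :=
  (hx.tendsto_zero.eventually_lt_const one_pos).exists

theorem measurable_mIdx {f : ℕ → ℝ → ℝ} (hf : ∀ i, Measurable (f i))
    (h1 : ∀ t, ∃ i, f i t < 1) : Measurable fun t => mIdx fun i => f i t := by
  classical
  have := measurable_find (p := fun t i => f i t < 1) h1
    (fun k => measurableSet_lt (hf k) measurable_const)
  convert this using 2 with t
  exact Nat.sInf_def (h1 t)

theorem measurable_overflow (lam : ℝ) {f : ℕ → ℝ → ℝ} (hf : ∀ i, Measurable (f i))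
    (h1 : ∀ t, ∃ i, f i t < 1) (j : ℕ) :
    Measurable fun t => overflow lam (fun i => f i t) j := by
  have hm := measurable_mIdx hf h1
  unfold overflow
  refine Measurable.ite (measurableSet_lt measurable_const hm) measurable_const ?_
  refine Measurable.ite (measurableSet_eq_fun measurable_const hm) ?_ measurable_const
  split_ifs
  · exact measurable_const
  · exact ((hf j).const_add _).max measurable_const

theorem intervalIntegrable_of_measurable_of_abs_le {f : ℝ → ℝ} (hf : Measurable f) {C : ℝ}
    (hC : ∀ t, |f t| ≤ C) (a b : ℝ) : IntervalIntegrable f volume a b :=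
  (intervalIntegrable_const (c := C)).mono_fun hf.aestronglyMeasurable
    (Eventually.of_forall fun t => by
      simpa using (hC t).trans (le_abs_self C))

/-- A function with an integrable derivative bound `c` on its absolute value; at zeros the bound
is only needed when the derivative vanishes. -/
theorem abs_integral_le_integral {b c : ℝ → ℝ} {C T : ℝ} (hT : 0 ≤ T)
    (hb : Measurable b) (hbC : ∀ t, |b t| ≤ C)
    (hc : IntervalIntegrable c volume 0 T)
    (hpos : ∀ t, 0 ≤ t → 0 < (∫ s in (0 : ℝ)..t, b s) → b t ≤ c t)
    (hneg : ∀ t, 0 ≤ t → (∫ s in (0 : ℝ)..t, b s) < 0 → -b t ≤ c t)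
    (hzero : ∀ t, 0 ≤ t → (∫ s in (0 : ℝ)..t, b s) = 0 → b t = 0 → 0 ≤ c t) :
    |∫ s in (0 : ℝ)..T, b s| ≤ ∫ s in (0 : ℝ)..T, c s := by
  have hint := intervalIntegrable_of_measurable_of_abs_le hb hbC
  set F : ℝ → ℝ := fun t => ∫ s in (0 : ℝ)..t, b s with hF
  have hC0 : 0 ≤ C := (abs_nonneg _).trans (hbC 0)
  have hlip : LipschitzWith C.toNNReal F := by
    refine LipschitzWith.of_dist_le_mul fun s t => ?_
    rw [Real.dist_eq, Real.dist_eq, Real.coe_toNNReal _ hC0, hF]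
    simp only
    rw [intervalIntegral.integral_interval_sub_left (hint _ _) (hint _ _)]
    exact intervalIntegral.norm_integral_le_of_norm_le_const (f := b) fun x _ => hbC x
  have hlip' : LipschitzWith C.toNNReal fun t => |F t| := by
    refine LipschitzWith.of_dist_le_mul fun s t => ?_
    refine le_trans ?_ (hlip.dist_le_mul s t)
    simpa [Real.dist_eq] using abs_abs_sub_abs_le_abs_sub (F s) (F t)
  have hac := (hlip'.lipschitzOnWith (s := uIcc 0 T)).absolutelyContinuousOnInterval
  have hftc := hac.integral_deriv_eq_sub
  have hF0 : F 0 = 0 := by simp [hF]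
  rw [hF0, abs_zero, sub_zero] at hftc
  rw [← hftc]
  refine intervalIntegral.integral_mono_ae_restrict hT hac.intervalIntegrable_deriv hc ?_
  have h1 := (hint 0 T).ae_hasDerivAt_integral
  have h2 := hac.ae_differentiableAt
  rw [EventuallyLE, ae_restrict_iff' measurableSet_Icc]
  filter_upwards [h1, h2] with t h1 h2 ht
  rw [uIcc_of_le hT] at h1 h2
  have hd : HasDerivAt F (b t) t := h1 ht 0 ⟨le_rfl, hT⟩
  have hd2 := (h2 ht).hasDerivAt
  rcases lt_trichotomy (F t) 0 with h | h | h
  · have : HasDerivAt (fun t => |F t|) (-b t) t := by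
      refine hd.neg.congr_of_eventuallyEq ?_
      filter_upwards [hd.continuousAt.eventually_lt_const h] with s hs
      exact abs_of_neg hs
    rw [this.deriv]
    exact hneg t ht.1 h
  · have hmin : IsLocalMin (fun t => |F t|) t := Eventually.of_forall fun s => by
      simp [h]
    have h0 := hmin.deriv_eq_zero
    rw [h0]
    refine hzero t ht.1 h ?_
    rw [h0] at hd2
    have : HasDerivAt F 0 t := by
      rw [hasDerivAt_iff_isLittleO] at hd2 ⊢
      simp only [h, abs_zero, sub_zero, smul_zero] at hd2 ⊢
      exact (Asymptotics.isLittleO_abs_left).1 hd2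
    exact hd.unique this
  · have : HasDerivAt (fun t => |F t|) (b t) t := by
      refine hd.congr_of_eventuallyEq ?_
      filter_upwards [hd.continuousAt.eventually_const_lt h] with s hs
      exact abs_of_pos hs
    rw [this.deriv]
    exact hpos t ht.1 h

theorem continuous_apply_of_tendsto_tsum {g : ℝ≥0 → ℕ → ℝ} (hg : ∀ t, Summable (g t))
    (hc : ∀ t₀ : ℝ≥0, Tendsto (fun t => ∑' i, |g t i - g t₀ i|) (𝓝 t₀) (𝓝 0)) (i : ℕ) :
    Continuous fun t => g t i := by
  refine continuous_iff_continuousAt.2 fun t₀ => ?_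
  rw [ContinuousAt, tendsto_iff_dist_tendsto_zero]
  refine squeeze_zero (fun _ => dist_nonneg) (fun t => ?_) (hc t₀)
  exact ((hg t).sub (hg t₀)).abs.le_tsum i fun _ _ => abs_nonneg _

/-- `ℓ¹`-contraction for the fluid equations, in the form of the vanishing of the difference of
two solutions with the same initial value. -/
theorem fluid_difference_eq_zero {r : ℕ → ℝ} {lam : ℝ} (hlam : 0 ≤ lam) {f f' : ℕ → ℝ → ℝ}
    (hf : ∀ t, MemLdown fun i => f i t) (hf' : ∀ t, MemLdown fun i => f' i t)
    (hfc : ∀ i, Continuous (f i)) (hfc' : ∀ i, Continuous (f' i)) {T : ℝ} (hT : 0 ≤ T)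
    (h : ∀ i t, 0 ≤ t → f i t = r i - (∫ s in (0 : ℝ)..t, (f i s - f (i + 1) s))
      + ∫ s in (0 : ℝ)..t, pcoef lam (fun j => f j s) i)
    (h' : ∀ i t, 0 ≤ t → f' i t = r i - (∫ s in (0 : ℝ)..t, (f' i s - f' (i + 1) s))
      + ∫ s in (0 : ℝ)..t, pcoef lam (fun j => f' j s) i) (i : ℕ) :
    f i T = f' i T := by
  set w : ℕ → ℝ → ℝ := fun j s => overflow lam (fun i => f i s) j with hw
  set w' : ℕ → ℝ → ℝ := fun j s => overflow lam (fun i => f' i s) j with hw'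
  have hwm : ∀ j, Measurable (w j) := fun j =>
    measurable_overflow lam (fun i => (hfc i).measurable) (fun t => (hf t).exists_lt_one) j
  have hwm' : ∀ j, Measurable (w' j) := fun j =>
    measurable_overflow lam (fun i => (hfc' i).measurable) (fun t => (hf' t).exists_lt_one) j
  have hw0 : ∀ j s, 0 ≤ w j s := fun j s => overflow_nonneg hlam _ j
  have hw0' : ∀ j s, 0 ≤ w' j s := fun j s => overflow_nonneg hlam _ j
  have hw1 : ∀ j s, w j s ≤ lam := fun j s => overflow_le hlam (fun i => ((hf s).1 i).2) j
  have hw1' : ∀ j s, w' j s ≤ lam := fun j s => overflow_le hlam (fun i => ((hf' s).1 i).2) j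
  have hz : ∀ j s, f j s < 1 → w (j + 1) s = 0 := fun j s hs => overflow_succ_eq_zero lam hs
  have hz' : ∀ j s, f' j s < 1 → w' (j + 1) s = 0 := fun j s hs => overflow_succ_eq_zero lam hs
  have hfb : ∀ j s, 0 ≤ f j s ∧ f j s ≤ 1 := fun j s => (hf s).1 j
  have hfb' : ∀ j s, 0 ≤ f' j s ∧ f' j s ≤ 1 := fun j s => (hf' s).1 j
  set b : ℕ → ℝ → ℝ := fun j s => ((w j s - w (j + 1) s) - (w' j s - w' (j + 1) s))
    - ((f j s - f (j + 1) s) - (f' j s - f' (j + 1) s)) with hb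
  set e : ℕ → ℝ → ℝ := fun j s => |f j s - f' j s| - |w j s - w' j s| with he
  have hbm : ∀ j, Measurable (b j) := fun j =>
    (((hwm j).sub (hwm (j + 1))).sub ((hwm' j).sub (hwm' (j + 1)))).sub
      (((hfc j).measurable.sub (hfc (j + 1)).measurable).sub
        ((hfc' j).measurable.sub (hfc' (j + 1)).measurable))
  have hbC : ∀ j s, |b j s| ≤ 2 + 2 * lam := by
    intro j s
    have h1 := hfb j s
    have h2 := hfb (j + 1) s
    have h3 := hfb' j s
    have h4 := hfb' (j + 1) s
    have h5 := hw0 j s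
    have h6 := hw0 (j + 1) s
    have h7 := hw0' j s
    have h8 := hw0' (j + 1) s
    have h9 := hw1 j s
    have h10 := hw1 (j + 1) s
    have h11 := hw1' j s
    have h12 := hw1' (j + 1) s
    rw [abs_le]
    constructor <;> simp only [hb] <;> linarith
  have hint1 : ∀ (j : ℕ) (t : ℝ), IntervalIntegrable (fun s => |f j s - f' j s|) volume 0 t :=
    fun j t => ((hfc j).sub (hfc' j)).abs.intervalIntegrable _ _
  have hint2 : ∀ (j : ℕ) (t : ℝ), IntervalIntegrable (fun s => |w j s - w' j s|) volume 0 t := by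
    intro j t
    refine intervalIntegrable_of_measurable_of_abs_le (C := lam)
      (by simpa using ((hwm j).sub (hwm' j)).norm) (fun s => ?_) _ _
    rw [abs_abs, abs_le]
    constructor <;> linarith [hw0 j s, hw0' j s, hw1 j s, hw1' j s]
  have hinte : ∀ (j : ℕ) (t : ℝ), IntervalIntegrable (e j) volume 0 t :=
    fun j t => (hint1 j t).sub (hint2 j t)
  have hdiff : ∀ (j : ℕ) (t : ℝ), 0 ≤ t → f j t - f' j t = ∫ s in (0 : ℝ)..t, b j s := by
    intro j t ht
    have hwi : ∀ j, IntervalIntegrable (w j) volume 0 t := fun j =>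
      intervalIntegrable_of_measurable_of_abs_le (hwm j) (C := lam)
        (fun s => abs_le.2 ⟨by linarith [hw0 j s], hw1 j s⟩) _ _
    have hwi' : ∀ j, IntervalIntegrable (w' j) volume 0 t := fun j =>
      intervalIntegrable_of_measurable_of_abs_le (hwm' j) (C := lam)
        (fun s => abs_le.2 ⟨by linarith [hw0' j s], hw1' j s⟩) _ _
    have hfi : ∀ j, IntervalIntegrable (f j) volume 0 t := fun j =>
      (hfc j).intervalIntegrable _ _
    have hfi' : ∀ j, IntervalIntegrable (f' j) volume 0 t := fun j =>
      (hfc' j).intervalIntegrable _ _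
    have e1 := h j t ht
    have e2 := h' j t ht
    simp only [pcoef_eq_overflow_sub] at e1 e2
    change f j t = r j - _ + ∫ s in (0 : ℝ)..t, (w j s - w (j + 1) s) at e1
    change f' j t = r j - _ + ∫ s in (0 : ℝ)..t, (w' j s - w' (j + 1) s) at e2
    simp only [hb]
    rw [intervalIntegral.integral_sub
        (((hwi _).sub (hwi _)).sub ((hwi' _).sub (hwi' _)))
        (((hfi _).sub (hfi _)).sub ((hfi' _).sub (hfi' _))),
      intervalIntegral.integral_sub ((hwi _).sub (hwi _)) ((hwi' _).sub (hwi' _)),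
      intervalIntegral.integral_sub ((hfi _).sub (hfi _)) ((hfi' _).sub (hfi' _))]
    linarith
  have key : ∀ j, |∫ s in (0 : ℝ)..T, b j s| ≤
      (∫ s in (0 : ℝ)..T, e (j + 1) s) - ∫ s in (0 : ℝ)..T, e j s := by
    intro j
    rw [← intervalIntegral.integral_sub (hinte _ _) (hinte _ _)]
    refine abs_integral_le_integral hT (hbm j) (hbC j)
      ((hinte _ _).sub (hinte _ _)) (fun t ht hd => ?_) (fun t ht hd => ?_)
      (fun t ht hd hbt => ?_)
    all_goals
      rw [← hdiff j t ht] at hd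
      have n1 := neg_abs_le (f (j + 1) t - f' (j + 1) t)
      have n2 := le_abs_self (f (j + 1) t - f' (j + 1) t)
      have n3 := neg_abs_le (w j t - w' j t)
      have n4 := le_abs_self (w j t - w' j t)
    · have h0 := hz' j t (by linarith [(hfb j t).2])
      simp only [he, hb, h0, sub_zero]
      rw [abs_of_pos hd, abs_of_nonneg (hw0 (j + 1) t)]
      linarith
    · have h0 := hz j t (by linarith [(hfb' j t).2])
      simp only [he, hb, h0, sub_zero, zero_sub, abs_neg]
      rw [abs_of_neg hd, abs_of_nonneg (hw0' (j + 1) t)]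
      linarith
    · simp only [hb] at hbt
      simp only [he]
      rw [hd, abs_zero]
      rcases abs_cases (w (j + 1) t - w' (j + 1) t) with ⟨h1, -⟩ | ⟨h1, -⟩ <;> rw [h1] <;> linarith
  have hsum : ∀ N, ∑ j ∈ Finset.range N, |∫ s in (0 : ℝ)..T, b j s| ≤
      ∫ s in (0 : ℝ)..T, |f N s - f' N s| := by
    intro N
    have h0 : 0 ≤ ∫ s in (0 : ℝ)..T, e 0 s := by
      refine intervalIntegral.integral_nonneg hT fun s _ => ?_
      simp only [he, hw, hw', overflow_zero, sub_self, abs_zero, sub_zero]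
      exact abs_nonneg _
    have hN : ∫ s in (0 : ℝ)..T, e N s ≤ ∫ s in (0 : ℝ)..T, |f N s - f' N s| := by
      refine intervalIntegral.integral_mono_on hT (hinte N T) (hint1 N T) fun s _ => ?_
      simp only [he]
      linarith [abs_nonneg (w N s - w' N s)]
    have := Finset.sum_le_sum fun j (_ : j ∈ Finset.range N) => key j
    rw [Finset.sum_range_sub (fun j => ∫ s in (0 : ℝ)..T, e j s)] at this
    linarith
  have hlim : Tendsto (fun N => ∫ s in (0 : ℝ)..T, |f N s - f' N s|) atTop (𝓝 0) := by
    have := intervalIntegral.tendsto_integral_filter_of_dominated_convergence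
      (μ := volume) (a := 0) (b := T) (l := atTop) (F := fun N s => |f N s - f' N s|)
      (f := fun _ => (0 : ℝ)) (fun _ => 1)
      (Eventually.of_forall fun N => ((hfc N).sub (hfc' N)).abs.aestronglyMeasurable)
      (Eventually.of_forall fun N => Eventually.of_forall fun s _ => by
        rw [Real.norm_eq_abs, abs_abs, abs_le]
        constructor <;> linarith [(hfb N s).1, (hfb N s).2, (hfb' N s).1, (hfb' N s).2])
      intervalIntegrable_const
      (Eventually.of_forall fun s _ => by
        simpa using ((hf s).tendsto_zero.sub (hf' s).tendsto_zero).abs)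
    simpa using this
  have hle : |∫ s in (0 : ℝ)..T, b i s| ≤ 0 := by
    refine ge_of_tendsto hlim ?_
    filter_upwards [eventually_gt_atTop i] with N hN
    exact (Finset.single_le_sum (f := fun j => |∫ s in (0 : ℝ)..T, b j s|)
      (fun j _ => abs_nonneg _) (Finset.mem_range.2 hN)).trans (hsum N)
  have := hdiff i T hT
  rw [abs_nonpos_iff.1 hle] at this
  linarith

theorem fluid_unique {r : ℕ → ℝ} {lam : ℝ} (hlam : 0 ≤ lam) {g g' : ℝ≥0 → ℕ → ℝ}
    (hg : ∀ t, MemLdown (g t)) (hg' : ∀ t, MemLdown (g' t))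
    (hc : ∀ t₀ : ℝ≥0, Tendsto (fun t => ∑' i, |g t i - g t₀ i|) (𝓝 t₀) (𝓝 0))
    (hc' : ∀ t₀ : ℝ≥0, Tendsto (fun t => ∑' i, |g' t i - g' t₀ i|) (𝓝 t₀) (𝓝 0))
    (h : ∀ i : ℕ, ∀ t : ℝ≥0,
      g t i = r i - (∫ s in (0:ℝ)..(t:ℝ), (g s.toNNReal i - g s.toNNReal (i+1)))
        + ∫ s in (0:ℝ)..(t:ℝ), pcoef lam (g s.toNNReal) i)
    (h' : ∀ i : ℕ, ∀ t : ℝ≥0,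
      g' t i = r i - (∫ s in (0:ℝ)..(t:ℝ), (g' s.toNNReal i - g' s.toNNReal (i+1)))
        + ∫ s in (0:ℝ)..(t:ℝ), pcoef lam (g' s.toNNReal) i) : g = g' := by
  funext T i
  have := fluid_difference_eq_zero hlam (r := r) (f := fun i s => g s.toNNReal i)
    (f' := fun i s => g' s.toNNReal i) (fun t => hg _) (fun t => hg' _)
    (fun i => (continuous_apply_of_tendsto_tsum (fun t => (hg t).2.2) hc i).comp
      continuous_real_toNNReal)
    (fun i => (continuous_apply_of_tendsto_tsum (fun t => (hg' t).2.2) hc' i).comp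
      continuous_real_toNNReal) T.2
    (fun i t ht => by simpa [Real.coe_toNNReal t ht] using h i t.toNNReal)
    (fun i t ht => by simpa [Real.coe_toNNReal t ht] using h' i t.toNNReal) i
  simpa using this

/-- The regulator of the one-dimensional Skorokhod problem with upper barrier `1`. -/
noncomputable def regulator (y : ℝ → ℝ) (t : ℝ) : ℝ :=
  sSup ((fun s => max (y s - 1) 0) '' Icc 0 t)

section Regulator

variable {y z : ℝ → ℝ} {s t : ℝ}

theorem exists_regulator_eq (hy : ContinuousOn y (Ici 0)) (ht : 0 ≤ t) :
    ∃ u ∈ Icc 0 t, regulator y t = max (y u - 1) 0 ∧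
      ∀ v ∈ Icc 0 t, max (y v - 1) 0 ≤ regulator y t := by
  have hc : ContinuousOn (fun s => max (y s - 1) 0) (Icc 0 t) :=
    ((hy.mono Icc_subset_Ici_self).sub continuousOn_const).sup continuousOn_const
  obtain ⟨u, hu, h1, h2⟩ := isCompact_Icc.exists_sSup_image_eq_and_ge ⟨0, le_rfl, ht⟩ hc
  refine ⟨u, hu, h1, fun v hv => ?_⟩
  rw [regulator, h1]
  exact h2 v hv

theorem le_regulator (hy : ContinuousOn y (Ici 0)) (hs : 0 ≤ s) (hst : s ≤ t) :
    max (y s - 1) 0 ≤ regulator y t := by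
  obtain ⟨u, -, -, h⟩ := exists_regulator_eq hy (hs.trans hst)
  exact h s ⟨hs, hst⟩

theorem regulator_nonneg (hy : ContinuousOn y (Ici 0)) (ht : 0 ≤ t) : 0 ≤ regulator y t :=
  (le_max_right _ _).trans (le_regulator hy ht le_rfl)

theorem sub_regulator_le_one (hy : ContinuousOn y (Ici 0)) (ht : 0 ≤ t) :
    y t - regulator y t ≤ 1 := by
  have := (le_max_left _ _).trans (le_regulator hy ht le_rfl)
  linarith

theorem regulator_mono (hy : ContinuousOn y (Ici 0)) (hs : 0 ≤ s) (hst : s ≤ t) :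
    regulator y s ≤ regulator y t := by
  obtain ⟨u, hu, h, -⟩ := exists_regulator_eq hy hs
  rw [h]
  exact le_regulator hy hu.1 (hu.2.trans hst)

theorem regulator_zero (hy : ContinuousOn y (Ici 0)) (h0 : y 0 ≤ 1) : regulator y 0 = 0 := by
  obtain ⟨u, hu, h, -⟩ := exists_regulator_eq hy le_rfl
  have : u = 0 := le_antisymm hu.2 hu.1
  rw [h, this]
  exact max_eq_right (by linarith)

/-- The regulator increases at most as much as any monotone function dominating the increments of
the driving path. -/
theorem regulator_sub_le (hy : ContinuousOn y (Ici 0)) {A : ℝ → ℝ} (hA : MonotoneOn A (Ici 0))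
    (hyA : ∀ u v, 0 ≤ u → u ≤ v → y v - y u ≤ A v - A u) (hs : 0 ≤ s) (hst : s ≤ t) :
    regulator y t - regulator y s ≤ A t - A s := by
  obtain ⟨u, hu, h, -⟩ := exists_regulator_eq hy (hs.trans hst)
  have hAst : A s ≤ A t := hA hs (hs.trans hst) hst
  rcases le_total u s with hus | hsu
  · have := le_regulator hy hu.1 hus
    linarith
  · have h1 := hyA s u hs hsu
    have h2 : A u ≤ A t := hA (hs.trans hsu) (hs.trans hst) hu.2
    have h3 := (le_max_left _ _).trans (le_regulator hy hs le_rfl)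
    have h4 := regulator_nonneg hy hs
    have : max (y u - 1) 0 ≤ regulator y s + (A t - A s) := max_le (by linarith) (by linarith)
    linarith

theorem abs_regulator_sub_le (hy : ContinuousOn y (Ici 0)) (hz : ContinuousOn z (Ici 0))
    (ht : 0 ≤ t) {B : ℝ} (hB : ∀ u ∈ Icc 0 t, |y u - z u| ≤ B) :
    |regulator y t - regulator z t| ≤ B := by
  obtain ⟨u, hu, h, -⟩ := exists_regulator_eq hy ht
  obtain ⟨v, hv, h', -⟩ := exists_regulator_eq hz ht
  have h1 := le_regulator hz hu.1 hu.2
  have h2 := le_regulator hy hv.1 hv.2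
  have h3 := abs_le.1 (hB u hu)
  have h4 := abs_le.1 (hB v hv)
  have h5 : 0 ≤ B := (abs_nonneg _).trans (hB u hu)
  have h6 : max (y u - 1) 0 ≤ max (z u - 1) 0 + B :=
    max_le (by linarith [le_max_left (z u - 1) 0]) (by linarith [le_max_right (z u - 1) 0])
  have h7 : max (z v - 1) 0 ≤ max (y v - 1) 0 + B :=
    max_le (by linarith [le_max_left (y v - 1) 0]) (by linarith [le_max_right (y v - 1) 0])
  rw [abs_le]
  constructor <;> linarith

/-- The regulator is constant while the regulated path stays below the barrier. -/
theorem regulator_eq_of_lt_one (hy : ContinuousOn y (Ici 0)) (hs : 0 ≤ s) (hst : s ≤ t)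
    (h1 : ∀ u ∈ Icc s t, y u - regulator y u < 1) : regulator y t = regulator y s := by
  refine le_antisymm ?_ (regulator_mono hy hs hst)
  obtain ⟨u, hu, h, -⟩ := exists_regulator_eq hy (hs.trans hst)
  rcases le_total u s with hus | hsu
  · rw [h]
    exact le_regulator hy hu.1 hus
  · have h2 := h1 u ⟨hsu, hu.2⟩
    have h3 := regulator_mono hy hu.1 hu.2
    have h4 := regulator_nonneg hy hs
    rcases max_cases (y u - 1) 0 with ⟨h5, -⟩ | ⟨h5, -⟩ <;> linarith

end Regulator

/-- A path that cannot increase while positive stays nonpositive. -/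
theorem nonpos_of_forall_le_of_pos {f : ℝ → ℝ} (hf : ContinuousOn f (Ici 0)) (h0 : f 0 ≤ 0)
    (h : ∀ s t, 0 ≤ s → s ≤ t → (∀ u ∈ Icc s t, 0 < f u) → f t ≤ f s) {t : ℝ} (ht : 0 ≤ t) :
    f t ≤ 0 := by
  by_contra! hpos
  set K := Icc 0 t ∩ f ⁻¹' Iic (f t / 2) with hK
  have hfc : ContinuousOn f (Icc 0 t) := hf.mono Icc_subset_Ici_self
  have hKc : IsCompact K := isCompact_Icc.of_isClosed_subset
    (hfc.preimage_isClosed_of_isClosed isClosed_Icc isClosed_Iic) inter_subset_left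
  obtain ⟨s, ⟨hs, hfs⟩, hmax⟩ := hKc.exists_isGreatest ⟨0, ⟨le_rfl, ht⟩, by
    rw [mem_preimage, mem_Iic]; linarith⟩
  rw [mem_preimage, mem_Iic] at hfs
  have hgt : ∀ u, s < u → u ≤ t → f t / 2 < f u := by
    intro u hsu hut
    by_contra! hu
    exact absurd (hmax ⟨⟨hs.1.trans hsu.le, hut⟩, hu⟩) (not_le.2 hsu)
  have hst : s < t := lt_of_le_of_ne hs.2 (by rintro rfl; linarith)
  have hge : f t / 2 ≤ f s := by
    have hcs : Tendsto f (𝓝[Ioc s t] s) (𝓝 (f s)) :=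
      (hf s hs.1).mono fun u hu => hs.1.trans hu.1.le
    have : (𝓝[Ioc s t] s).NeBot := by
      rw [← mem_closure_iff_nhdsWithin_neBot, closure_Ioc hst.ne]
      exact ⟨le_rfl, hst.le⟩
    refine ge_of_tendsto hcs ?_
    filter_upwards [self_mem_nhdsWithin] with u hu
    exact (hgt u hu.1 hu.2).le
  have := h s t hs.1 hst.le fun u hu => by
    rcases hu.1.eq_or_lt with rfl | hlt
    · linarith
    · linarith [hgt u hlt hu.2]
  linarith

/-- The truncated departure rate `(g_i - g_{i+1})` used in the Picard iteration. -/
noncomputable def drift (g : ℕ → ℝ → ℝ) (i : ℕ) (s : ℝ) : ℝ :=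
  max (min (g i s) 1 - max (g (i + 1) s) 0) 0

/-- The cumulative overflow into queues of length at least `i` driven by the departures of `g`. -/
noncomputable def push (r : ℕ → ℝ) (lam : ℝ) (g : ℕ → ℝ → ℝ) : ℕ → ℝ → ℝ
  | 0, t => lam * t
  | i + 1, t => regulator (fun s => r i - (∫ u in (0 : ℝ)..s, drift g i u) + push r lam g i s) t

/-- The unregulated path of coordinate `i`. -/
noncomputable def free (r : ℕ → ℝ) (lam : ℝ) (g : ℕ → ℝ → ℝ) (i : ℕ) (t : ℝ) : ℝ :=
  r i - (∫ u in (0 : ℝ)..t, drift g i u) + push r lam g i t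

/-- The Picard map. -/
noncomputable def picard (r : ℕ → ℝ) (lam : ℝ) (g : ℕ → ℝ → ℝ) (i : ℕ) (t : ℝ) : ℝ :=
  free r lam g i t - push r lam g (i + 1) t

theorem drift_nonneg (g : ℕ → ℝ → ℝ) (i : ℕ) (s : ℝ) : 0 ≤ drift g i s := le_max_right _ _

theorem drift_le_one (g : ℕ → ℝ → ℝ) (i : ℕ) (s : ℝ) : drift g i s ≤ 1 :=
  max_le (by linarith [min_le_right (g i s) 1, le_max_right (g (i + 1) s) 0]) zero_le_one

theorem abs_drift_sub_le (g g' : ℕ → ℝ → ℝ) (i : ℕ) (s : ℝ) :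
    |drift g i s - drift g' i s| ≤ |g i s - g' i s| + |g (i + 1) s - g' (i + 1) s| := by
  have h1 := abs_max_sub_max_le_abs (min (g i s) 1 - max (g (i + 1) s) 0)
    (min (g' i s) 1 - max (g' (i + 1) s) 0) 0
  have h2 := abs_max_sub_max_le_abs (g (i + 1) s) (g' (i + 1) s) 0
  have h3 : |min (g i s) 1 - min (g' i s) 1| ≤ |g i s - g' i s| := by
    simpa using abs_min_sub_min_le_max (g i s) 1 (g' i s) 1
  have h4 := abs_sub (min (g i s) 1 - min (g' i s) 1) (max (g (i + 1) s) 0 - max (g' (i + 1) s) 0)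
  have h5 : min (g i s) 1 - max (g (i + 1) s) 0 - (min (g' i s) 1 - max (g' (i + 1) s) 0)
    = min (g i s) 1 - min (g' i s) 1 - (max (g (i + 1) s) 0 - max (g' (i + 1) s) 0) := by ring
  rw [h5] at h1
  unfold drift
  linarith

/-- Continuity of all coordinates on the half line. -/
def CoordContinuous (g : ℕ → ℝ → ℝ) : Prop := ∀ i, ContinuousOn (g i) (Ici 0)

theorem CoordContinuous.drift {g : ℕ → ℝ → ℝ} (hg : CoordContinuous g) (i : ℕ) :
    ContinuousOn (drift g i) (Ici 0) :=
  (((hg i).inf continuousOn_const).sub ((hg (i + 1)).sup continuousOn_const)).sup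
    continuousOn_const

theorem intervalIntegrable_of_continuousOn_Ici {f : ℝ → ℝ} (hf : ContinuousOn f (Ici 0)) {s t : ℝ}
    (hs : 0 ≤ s) (ht : 0 ≤ t) : IntervalIntegrable f volume s t :=
  (hf.mono fun _ hu => (le_min hs ht).trans hu.1).intervalIntegrable

theorem continuousOn_Ici_of_abs_sub_le {f : ℝ → ℝ} {L : ℝ}
    (h : ∀ s t, 0 ≤ s → s ≤ t → |f t - f s| ≤ L * (t - s)) : ContinuousOn f (Ici 0) := by
  have hL : 0 ≤ L := by simpa using (abs_nonneg _).trans (h 0 1 le_rfl zero_le_one)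
  refine LipschitzOnWith.continuousOn (K := L.toNNReal) (LipschitzOnWith.of_dist_le_mul ?_)
  intro s hs t ht
  rw [Real.coe_toNNReal _ hL, Real.dist_eq, Real.dist_eq]
  rcases le_total s t with hst | hst
  · rw [abs_sub_comm, abs_sub_comm s t, abs_of_nonneg (sub_nonneg.2 hst)]
    exact h s t hs hst
  · rw [abs_of_nonneg (sub_nonneg.2 hst)]
    exact h t s ht hst

section Picard

variable {r : ℕ → ℝ} {lam : ℝ} {g : ℕ → ℝ → ℝ}

theorem CoordContinuous.integral_drift_sub (hg : CoordContinuous g) (i : ℕ) {s t : ℝ} (hs : 0 ≤ s)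
    (ht : 0 ≤ t) : (∫ u in (0 : ℝ)..t, _root_.drift g i u) - ∫ u in (0 : ℝ)..s, _root_.drift g i u
      = ∫ u in s..t, _root_.drift g i u :=
  intervalIntegral.integral_interval_sub_left
    (intervalIntegrable_of_continuousOn_Ici (hg.drift i) le_rfl ht)
    (intervalIntegrable_of_continuousOn_Ici (hg.drift i) le_rfl hs)

theorem integral_drift_nonneg (g : ℕ → ℝ → ℝ) (i : ℕ) {s t : ℝ} (hst : s ≤ t) :
    0 ≤ ∫ u in s..t, drift g i u :=
  intervalIntegral.integral_nonneg hst fun u _ => drift_nonneg g i u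

theorem integral_drift_le (g : ℕ → ℝ → ℝ) (i : ℕ) {s t : ℝ} (hst : s ≤ t) :
    ∫ u in s..t, drift g i u ≤ t - s := by
  have := intervalIntegral.norm_integral_le_of_norm_le_const (a := s) (b := t) (C := 1)
    (f := drift g i) fun u _ => by
      rw [Real.norm_eq_abs, abs_of_nonneg (drift_nonneg g i u)]; exact drift_le_one g i u
  rw [Real.norm_eq_abs, abs_of_nonneg (integral_drift_nonneg g i hst),
    abs_of_nonneg (sub_nonneg.2 hst)] at this
  linarith

theorem continuousOn_push_aux (hlam : 0 ≤ lam) (hg : CoordContinuous g) (i : ℕ) :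
    ContinuousOn (push r lam g i) (Ici 0) ∧ MonotoneOn (push r lam g i) (Ici 0) ∧
      ∀ s t, 0 ≤ s → s ≤ t → push r lam g i t - push r lam g i s ≤ lam * (t - s) := by
  induction i with
  | zero =>
    refine ⟨by simp only [push]; fun_prop, fun s _ t _ hst => ?_, fun s t _ _ => ?_⟩
    · simp only [push]; gcongr
    · simp only [push]; linarith
  | succ i ih =>
    obtain ⟨hc, hm, hl⟩ := ih
    have hinc : ∀ u v, 0 ≤ u → u ≤ v →
        free r lam g i v - free r lam g i u ≤ push r lam g i v - push r lam g i u := by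
      intro u v hu huv
      have h1 := hg.integral_drift_sub i hu (hu.trans huv)
      have h2 := integral_drift_nonneg g i huv
      simp only [free]
      linarith
    have hfree : ContinuousOn (free r lam g i) (Ici 0) := by
      refine continuousOn_Ici_of_abs_sub_le (L := 1 + lam) fun s t hs hst => ?_
      have h1 := hg.integral_drift_sub i hs (hs.trans hst)
      have h2 := integral_drift_nonneg g i hst
      have h3 := integral_drift_le g i hst
      have h4 := hl s t hs hst
      have h5 := hm hs (hs.trans hst) hst
      have h6 : 0 ≤ lam * (t - s) := mul_nonneg hlam (sub_nonneg.2 hst)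
      simp only [free]
      rw [abs_le]
      constructor <;> linarith
    have hm' : MonotoneOn (push r lam g (i + 1)) (Ici 0) := fun s hs t _ hst =>
      regulator_mono hfree hs hst
    have hl' : ∀ s t, 0 ≤ s → s ≤ t →
        push r lam g (i + 1) t - push r lam g (i + 1) s ≤ lam * (t - s) := fun s t hs hst =>
      (regulator_sub_le hfree hm hinc hs hst).trans (hl s t hs hst)
    refine ⟨continuousOn_Ici_of_abs_sub_le (L := lam) fun s t hs hst => ?_, hm', hl'⟩
    rw [abs_of_nonneg (sub_nonneg.2 (hm' hs (hs.trans hst) hst))]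
    exact hl' s t hs hst

theorem continuousOn_push (hlam : 0 ≤ lam) (hg : CoordContinuous g) (i : ℕ) :
    ContinuousOn (push r lam g i) (Ici 0) := (continuousOn_push_aux hlam hg i).1

theorem monotoneOn_push (hlam : 0 ≤ lam) (hg : CoordContinuous g) (i : ℕ) :
    MonotoneOn (push r lam g i) (Ici 0) := (continuousOn_push_aux hlam hg i).2.1

theorem push_sub_le (hlam : 0 ≤ lam) (hg : CoordContinuous g) (i : ℕ) {s t : ℝ} (hs : 0 ≤ s)
    (hst : s ≤ t) : push r lam g i t - push r lam g i s ≤ lam * (t - s) :=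
  (continuousOn_push_aux hlam hg i).2.2 s t hs hst

theorem continuousOn_free (hlam : 0 ≤ lam) (hg : CoordContinuous g) (i : ℕ) :
    ContinuousOn (free r lam g i) (Ici 0) := by
  have : ContinuousOn (fun t => ∫ u in (0 : ℝ)..t, drift g i u) (Ici 0) := by
    refine continuousOn_Ici_of_abs_sub_le (L := 1) fun s t hs hst => ?_
    rw [hg.integral_drift_sub i hs (hs.trans hst), abs_of_nonneg (integral_drift_nonneg g i hst),
      one_mul]
    exact integral_drift_le g i hst
  exact (continuousOn_const.sub this).add (continuousOn_push hlam hg i)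

theorem push_succ_sub_le (hlam : 0 ≤ lam) (hg : CoordContinuous g) (i : ℕ) {s t : ℝ} (hs : 0 ≤ s)
    (hst : s ≤ t) : push r lam g (i + 1) t - push r lam g (i + 1) s ≤
      push r lam g i t - push r lam g i s := by
  refine regulator_sub_le (continuousOn_free hlam hg i) (monotoneOn_push hlam hg i)
    (fun u v hu huv => ?_) hs hst
  have h1 := hg.integral_drift_sub i hu (hu.trans huv)
  have h2 := integral_drift_nonneg g i huv
  simp only [free]
  linarith

theorem push_at_zero (hlam : 0 ≤ lam) (hr : ∀ i, r i ≤ 1) (hg : CoordContinuous g) (i : ℕ) :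
    push r lam g i 0 = 0 := by
  induction i with
  | zero => simp [push]
  | succ i ih => exact regulator_zero (continuousOn_free hlam hg i) (by simp [ih, hr])

theorem picard_sub (hg : CoordContinuous g) (i : ℕ) {s t : ℝ} (hs : 0 ≤ s) (ht : 0 ≤ t) :
    picard r lam g i t - picard r lam g i s = (push r lam g i t - push r lam g i s)
      - (push r lam g (i + 1) t - push r lam g (i + 1) s) - ∫ u in s..t, drift g i u := by
  rw [← hg.integral_drift_sub i hs ht]
  simp only [picard, free]
  ring

theorem abs_picard_sub_le (hlam : 0 ≤ lam) (hg : CoordContinuous g) (i : ℕ) {s t : ℝ} (hs : 0 ≤ s)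
    (hst : s ≤ t) : |picard r lam g i t - picard r lam g i s| ≤
      (push r lam g i t - push r lam g i s) - (push r lam g (i + 1) t - push r lam g (i + 1) s)
        + ∫ u in s..t, drift g i u := by
  rw [picard_sub hg i hs (hs.trans hst), abs_le]
  have h2 := integral_drift_nonneg g i hst
  have h4 := push_succ_sub_le (r := r) hlam hg i hs hst
  constructor <;> linarith

theorem abs_picard_sub_le_mul (hlam : 0 ≤ lam) (hg : CoordContinuous g) (i : ℕ) {s t : ℝ}
    (hs : 0 ≤ s) (hst : s ≤ t) :
    |picard r lam g i t - picard r lam g i s| ≤ (1 + lam) * (t - s) := by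
  refine (abs_picard_sub_le hlam hg i hs hst).trans ?_
  have h3 := integral_drift_le g i hst
  have h4 := push_sub_le (r := r) hlam hg i hs hst
  have h5 := monotoneOn_push (r := r) hlam hg (i + 1) hs (hs.trans hst) hst
  linarith

theorem picard_at_zero (hlam : 0 ≤ lam) (hr : ∀ i, r i ≤ 1) (hg : CoordContinuous g) (i : ℕ) :
    picard r lam g i 0 = r i := by
  simp [picard, free, push_at_zero hlam hr hg]

theorem picard_le_one (hlam : 0 ≤ lam) (hg : CoordContinuous g) (i : ℕ) {t : ℝ} (ht : 0 ≤ t) :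
    picard r lam g i t ≤ 1 :=
  sub_regulator_le_one (continuousOn_free hlam hg i) ht

theorem abs_integral_drift_sub_le {g' : ℕ → ℝ → ℝ} (hg : CoordContinuous g)
    (hg' : CoordContinuous g') {M : ℝ}
    (hM : ∀ i t, 0 ≤ t → |g i t - g' i t| ≤ M * 2 ^ i * Real.exp (24 * t)) (i : ℕ) {t : ℝ}
    (ht : 0 ≤ t) :
    |(∫ u in (0 : ℝ)..t, drift g i u) - ∫ u in (0 : ℝ)..t, drift g' i u| ≤
      M / 8 * 2 ^ i * Real.exp (24 * t) := by
  have hM0 : 0 ≤ M := by simpa using (abs_nonneg _).trans (hM 0 0 le_rfl)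
  have hexp : ∫ u in (0 : ℝ)..t, Real.exp (24 * u) = (Real.exp (24 * t) - 1) / 24 := by
    rw [intervalIntegral.integral_comp_mul_left (fun u => Real.exp u) (by norm_num)]
    simp [integral_exp]
    ring
  rw [← intervalIntegral.integral_sub
    (intervalIntegrable_of_continuousOn_Ici (hg.drift i) le_rfl ht)
    (intervalIntegrable_of_continuousOn_Ici (hg'.drift i) le_rfl ht)]
  have hbound : ∀ u ∈ Ioc 0 t, ‖drift g i u - drift g' i u‖ ≤
      3 * M * 2 ^ i * Real.exp (24 * u) := by
    intro u hu
    have h1 := hM i u hu.1.le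
    have h2 := hM (i + 1) u hu.1.le
    rw [pow_succ] at h2
    refine (abs_drift_sub_le g g' i u).trans ?_
    linarith
  have hint : IntervalIntegrable (fun u => 3 * M * 2 ^ i * Real.exp (24 * u)) volume 0 t :=
    Continuous.intervalIntegrable (by fun_prop) _ _
  have := intervalIntegral.norm_integral_le_of_norm_le ht
    (Eventually.of_forall hbound) hint
  rw [intervalIntegral.integral_const_mul, hexp, Real.norm_eq_abs] at this
  have h0 : 0 ≤ M * 2 ^ i := by positivity
  refine this.trans ?_
  linarith

/-- The Picard map is a contraction in an exponentially weighted norm. -/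
theorem abs_picard_sub_picard_le {g' : ℕ → ℝ → ℝ} (hlam : 0 ≤ lam) (hg : CoordContinuous g)
    (hg' : CoordContinuous g') {M : ℝ}
    (hM : ∀ i t, 0 ≤ t → |g i t - g' i t| ≤ M * 2 ^ i * Real.exp (24 * t)) (i : ℕ) {t : ℝ}
    (ht : 0 ≤ t) :
    |picard r lam g i t - picard r lam g' i t| ≤ M / 2 * 2 ^ i * Real.exp (24 * t) := by
  have hM0 : 0 ≤ M := by simpa using (abs_nonneg _).trans (hM 0 0 le_rfl)
  have hfree : ∀ i t, 0 ≤ t →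
      |push r lam g i t - push r lam g' i t| ≤ M / 8 * 2 ^ i * Real.exp (24 * t) →
      |free r lam g i t - free r lam g' i t| ≤ M / 8 * 2 ^ (i + 1) * Real.exp (24 * t) := by
    intro i t ht hp
    have h1 := abs_le.1 (abs_integral_drift_sub_le hg hg' hM i ht)
    have h2 := abs_le.1 hp
    rw [pow_succ]
    simp only [free]
    rw [abs_le]
    constructor <;> linarith
  have hpush : ∀ i t, 0 ≤ t →
      |push r lam g i t - push r lam g' i t| ≤ M / 8 * 2 ^ i * Real.exp (24 * t) := by
    intro i
    induction i with
    | zero =>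
      intro t ht
      simp only [push, sub_self, abs_zero]
      positivity
    | succ i ih =>
      intro t ht
      refine abs_regulator_sub_le (continuousOn_free hlam hg i) (continuousOn_free hlam hg' i) ht
        fun u hu => (hfree i u hu.1 (ih u hu.1)).trans ?_
      gcongr
      exact hu.2
  have h1 := abs_le.1 (hfree i t ht (hpush i t ht))
  have h2 := abs_le.1 (hpush (i + 1) t ht)
  rw [pow_succ] at h1 h2
  simp only [picard]
  rw [abs_le]
  constructor <;> linarith

/-- Iterates of the Picard map started at the constant path. -/
noncomputable def picardSeq (r : ℕ → ℝ) (lam : ℝ) : ℕ → ℕ → ℝ → ℝ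
  | 0 => fun i _ => r i
  | n + 1 => picard r lam (picardSeq r lam n)

theorem abs_picardSeq_sub_le (hlam : 0 ≤ lam) (n i : ℕ) :
    ∀ s t, 0 ≤ s → s ≤ t →
      |picardSeq r lam n i t - picardSeq r lam n i s| ≤ (1 + lam) * (t - s) := by
  induction n generalizing i with
  | zero =>
    intro s t hs hst
    simp only [picardSeq, sub_self, abs_zero]
    exact mul_nonneg (by linarith) (sub_nonneg.2 hst)
  | succ n ih =>
    intro s t hs hst
    exact abs_picard_sub_le_mul hlam (fun j => continuousOn_Ici_of_abs_sub_le (ih j)) i hs hst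

theorem exists_picard_fixedPoint (hlam : 0 ≤ lam) (hr : ∀ i, r i ≤ 1) :
    ∃ g : ℕ → ℝ → ℝ, CoordContinuous g ∧ ∀ i t, 0 ≤ t → g i t = picard r lam g i t := by
  have hc : ∀ n, CoordContinuous (picardSeq r lam n) := fun n i =>
    continuousOn_Ici_of_abs_sub_le (abs_picardSeq_sub_le hlam n i)
  have hstep : ∀ n i t, 0 ≤ t → |picardSeq r lam n i t - picardSeq r lam (n + 1) i t| ≤
      (1 + lam) * (1 / 2) ^ n * 2 ^ i * Real.exp (24 * t) := by
    intro n
    induction n with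
    | zero =>
      intro i t ht
      have h1 := abs_picard_sub_le_mul (r := r) hlam (hc 0) i le_rfl ht
      rw [picard_at_zero hlam hr (hc 0), abs_sub_comm, sub_zero] at h1
      refine h1.trans ?_
      have h2 : t ≤ Real.exp (24 * t) := by linarith [Real.add_one_le_exp (24 * t)]
      have h3 : (1 : ℝ) ≤ 2 ^ i := one_le_pow₀ (by norm_num)
      rw [pow_zero, mul_one, mul_assoc]
      refine mul_le_mul_of_nonneg_left ?_ (by linarith)
      nlinarith [Real.exp_pos (24 * t)]
    | succ n ih =>
      intro i t ht
      have := abs_picard_sub_picard_le (r := r) hlam (hc n) (hc (n + 1)) ih i ht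
      refine this.trans (le_of_eq ?_)
      rw [pow_succ]
      ring
  have hlim : ∀ i t, ∃ a, 0 ≤ t → Tendsto (fun n => picardSeq r lam n i t) atTop (𝓝 a) ∧
      ∀ n, |picardSeq r lam n i t - a| ≤
        2 * (1 + lam) * (1 / 2) ^ n * 2 ^ i * Real.exp (24 * t) := by
    intro i t
    by_cases ht : 0 ≤ t
    · have hd : ∀ n, dist (picardSeq r lam n i t) (picardSeq r lam (n + 1) i t) ≤
          ((1 + lam) * 2 ^ i * Real.exp (24 * t)) * (1 / 2) ^ n := fun n =>
        (hstep n i t ht).trans (le_of_eq (by ring))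
      obtain ⟨a, ha⟩ := cauchySeq_tendsto_of_complete
        (cauchySeq_of_le_geometric _ _ (by norm_num) hd)
      refine ⟨a, fun _ => ⟨ha, fun n => ?_⟩⟩
      refine (dist_le_of_le_geometric_of_tendsto _ _ (by norm_num) hd ha n).trans (le_of_eq ?_)
      ring
    · exact ⟨0, fun h => absurd h ht⟩
  choose g hg using hlim
  have hgc : CoordContinuous g := fun i => by
    refine continuousOn_Ici_of_abs_sub_le (L := 1 + lam) fun s t hs hst => ?_
    exact le_of_tendsto (((hg i t (hs.trans hst)).1.sub (hg i s hs).1).abs)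
      (Eventually.of_forall fun n => abs_picardSeq_sub_le hlam n i s t hs hst)
  refine ⟨g, hgc, fun i t ht => ?_⟩
  have h1 : Tendsto (fun n => picardSeq r lam (n + 1) i t) atTop (𝓝 (g i t)) :=
    (hg i t ht).1.comp (tendsto_add_atTop_nat 1)
  refine tendsto_nhds_unique h1 ?_
  rw [tendsto_iff_dist_tendsto_zero]
  have h2 : ∀ n, dist (picardSeq r lam (n + 1) i t) (picard r lam g i t) ≤
      ((1 + lam) * 2 ^ i * Real.exp (24 * t)) * (1 / 2) ^ n := fun n =>
    (abs_picard_sub_picard_le hlam (hc n) hgc (fun j u hu => (hg j u hu).2 n) i ht).trans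
      (le_of_eq (by ring))
  refine squeeze_zero (fun _ => dist_nonneg) h2 ?_
  simpa using (tendsto_pow_atTop_nhds_zero_of_lt_one (r := (1 / 2 : ℝ)) (by norm_num)
    (by norm_num)).const_mul ((1 + lam) * 2 ^ i * Real.exp (24 * t))

end Picard

section FixedPoint

variable {r : ℕ → ℝ} {lam : ℝ} {g : ℕ → ℝ → ℝ}

theorem push_succ_eq_of_lt_one (hlam : 0 ≤ lam) (hg : CoordContinuous g)
    (hfix : ∀ i t, 0 ≤ t → g i t = picard r lam g i t) (i : ℕ) {s t : ℝ} (hs : 0 ≤ s)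
    (hst : s ≤ t) (h : ∀ u ∈ Icc s t, g i u < 1) :
    push r lam g (i + 1) t = push r lam g (i + 1) s :=
  regulator_eq_of_lt_one (continuousOn_free hlam hg i) hs hst fun u hu => by
    have := h u hu
    rwa [hfix i u (hs.trans hu.1)] at this

theorem fixedPoint_nonneg (hlam : 0 ≤ lam) (hr : MemLdown r) (hg : CoordContinuous g)
    (hfix : ∀ i t, 0 ≤ t → g i t = picard r lam g i t) (i : ℕ) {t : ℝ} (ht : 0 ≤ t) :
    0 ≤ g i t := by
  have := nonpos_of_forall_le_of_pos (f := fun t => -g i t) (hg i).neg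
    (by simpa [hfix i 0 le_rfl, picard_at_zero hlam (fun i => (hr.1 i).2) hg] using (hr.1 i).1)
    (fun s t hs hst hneg => ?_) ht
  · linarith
  have h1 := picard_sub (r := r) (lam := lam) hg i hs (hs.trans hst)
  have h2 := push_succ_eq_of_lt_one hlam hg hfix i hs hst fun u hu => by linarith [hneg u hu]
  have h3 := monotoneOn_push (r := r) hlam hg i hs (hs.trans hst) hst
  have h4 : ∫ u in s..t, drift g i u = 0 := by
    rw [intervalIntegral.integral_congr (g := fun _ => (0 : ℝ)) fun u hu => ?_]
    · simp
    · rw [uIcc_of_le hst] at hu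
      have := hneg u hu
      exact max_eq_right (by linarith [min_le_left (g i u) 1, le_max_right (g (i + 1) u) 0])
  rw [← hfix i s hs, ← hfix i t (hs.trans hst), h2, h4] at h1
  linarith

theorem fixedPoint_succ_le (hlam : 0 ≤ lam) (hr : MemLdown r) (hg : CoordContinuous g)
    (hfix : ∀ i t, 0 ≤ t → g i t = picard r lam g i t) (i : ℕ) {t : ℝ} (ht : 0 ≤ t) :
    g (i + 1) t ≤ g i t := by
  have := nonpos_of_forall_le_of_pos (f := fun t => g (i + 1) t - g i t)
    ((hg (i + 1)).sub (hg i))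
    (by simpa [hfix _ 0 le_rfl, picard_at_zero hlam (fun i => (hr.1 i).2) hg] using hr.2.1 i)
    (fun s t hs hst hpos => ?_) ht
  · linarith
  have hle1 : ∀ u ∈ Icc s t, g (i + 1) u ≤ 1 := fun u hu => by
    rw [hfix _ u (hs.trans hu.1)]
    exact picard_le_one hlam hg _ (hs.trans hu.1)
  have h1 := picard_sub (r := r) (lam := lam) hg i hs (hs.trans hst)
  have h1' := picard_sub (r := r) (lam := lam) hg (i + 1) hs (hs.trans hst)
  have h2 := push_succ_eq_of_lt_one hlam hg hfix i hs hst fun u hu => by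
    linarith [hpos u hu, hle1 u hu]
  have h3 := monotoneOn_push (r := r) hlam hg i hs (hs.trans hst) hst
  have h3' := monotoneOn_push (r := r) hlam hg (i + 1 + 1) hs (hs.trans hst) hst
  have h4 : ∫ u in s..t, drift g i u = 0 := by
    rw [intervalIntegral.integral_congr (g := fun _ => (0 : ℝ)) fun u hu => ?_]
    · simp
    · rw [uIcc_of_le hst] at hu
      have := hpos u hu
      exact max_eq_right (by linarith [min_le_left (g i u) 1, le_max_left (g (i + 1) u) 0])
  have h5 := integral_drift_nonneg g (i + 1) hst
  rw [← hfix i s hs, ← hfix i t (hs.trans hst), h2, h4] at h1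
  rw [← hfix _ s hs, ← hfix _ t (hs.trans hst), h2] at h1'
  linarith

theorem fixedPoint_le_one (hlam : 0 ≤ lam) (hg : CoordContinuous g)
    (hfix : ∀ i t, 0 ≤ t → g i t = picard r lam g i t) (i : ℕ) {t : ℝ} (ht : 0 ≤ t) :
    g i t ≤ 1 := by
  rw [hfix i t ht]
  exact picard_le_one hlam hg i ht

theorem drift_fixedPoint (hlam : 0 ≤ lam) (hr : MemLdown r) (hg : CoordContinuous g)
    (hfix : ∀ i t, 0 ≤ t → g i t = picard r lam g i t) (i : ℕ) {t : ℝ} (ht : 0 ≤ t) :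
    drift g i t = g i t - g (i + 1) t := by
  have h1 := fixedPoint_succ_le hlam hr hg hfix i ht
  rw [drift, min_eq_left (fixedPoint_le_one hlam hg hfix i ht),
    max_eq_left (fixedPoint_nonneg hlam hr hg hfix (i + 1) ht), max_eq_left (by linarith)]

theorem memLdown_fixedPoint (hlam : 0 ≤ lam) (hr : MemLdown r) (hg : CoordContinuous g)
    (hfix : ∀ i t, 0 ≤ t → g i t = picard r lam g i t) {t : ℝ} (ht : 0 ≤ t) :
    MemLdown fun i => g i t := by
  refine ⟨fun i => ⟨fixedPoint_nonneg hlam hr hg hfix i ht, fixedPoint_le_one hlam hg hfix i ht⟩,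
    fun i => fixedPoint_succ_le hlam hr hg hfix i ht,
    summable_of_sum_range_le (c := (∑' i, r i) + lam * t)
      (fun i => fixedPoint_nonneg hlam hr hg hfix i ht) fun n => ?_⟩
  have h1 : ∀ i ∈ Finset.range n, g i t ≤
      r i + (push r lam g i t - push r lam g (i + 1) t) := fun i _ => by
    have := integral_drift_nonneg g i ht
    rw [hfix i t ht]
    simp only [picard, free]
    linarith
  refine (Finset.sum_le_sum h1).trans ?_
  rw [Finset.sum_add_distrib, Finset.sum_range_sub' (fun i => push r lam g i t)]
  have h2 := hr.2.2.sum_le_tsum (Finset.range n) fun i _ => (hr.1 i).1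
  have h3 := monotoneOn_push (r := r) hlam hg n self_mem_Ici ht ht
  rw [push_at_zero hlam (fun i => (hr.1 i).2) hg] at h3
  have h4 : push r lam g 0 t = lam * t := rfl
  linarith

theorem tsum_abs_fixedPoint_sub_le (hlam : 0 ≤ lam) (hr : MemLdown r) (hg : CoordContinuous g)
    (hfix : ∀ i t, 0 ≤ t → g i t = picard r lam g i t) {s t : ℝ} (hs : 0 ≤ s) (hst : s ≤ t) :
    ∑' i, |g i t - g i s| ≤ (1 + lam) * (t - s) := by
  have ht := hs.trans hst
  refine Real.tsum_le_of_sum_range_le (fun i => abs_nonneg _) fun n => ?_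
  have h1 : ∀ i ∈ Finset.range n, |g i t - g i s| ≤
      ((push r lam g i t - push r lam g i s)
        - (push r lam g (i + 1) t - push r lam g (i + 1) s))
        + ((∫ u in s..t, g i u) - ∫ u in s..t, g (i + 1) u) := fun i _ => by
    rw [hfix i t ht, hfix i s hs, ← intervalIntegral.integral_sub
      (intervalIntegrable_of_continuousOn_Ici (hg _) hs ht)
      (intervalIntegrable_of_continuousOn_Ici (hg _) hs ht)]
    refine (abs_picard_sub_le hlam hg i hs hst).trans (le_of_eq ?_)
    congr 1
    refine intervalIntegral.integral_congr fun u hu => ?_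
    rw [uIcc_of_le hst] at hu
    exact drift_fixedPoint hlam hr hg hfix i (hs.trans hu.1)
  refine (Finset.sum_le_sum h1).trans ?_
  rw [Finset.sum_add_distrib,
    Finset.sum_range_sub' (fun i => push r lam g i t - push r lam g i s),
    Finset.sum_range_sub' (fun i => ∫ u in s..t, g i u)]
  have h2 := push_sub_le (r := r) hlam hg 0 hs hst
  have h3 := monotoneOn_push (r := r) hlam hg n hs ht hst
  have h4 : ∫ u in s..t, g 0 u ≤ ∫ _u in s..t, (1 : ℝ) :=
    intervalIntegral.integral_mono_on hst (intervalIntegrable_of_continuousOn_Ici (hg _) hs ht)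
      intervalIntegrable_const fun u hu => fixedPoint_le_one hlam hg hfix 0 (hs.trans hu.1)
  have h5 : 0 ≤ ∫ u in s..t, g n u := intervalIntegral.integral_nonneg hst fun u hu =>
    fixedPoint_nonneg hlam hr hg hfix n (hs.trans hu.1)
  rw [intervalIntegral.integral_const, smul_eq_mul, mul_one] at h4
  linarith

theorem eq_overflow {lam : ℝ} {x w : ℕ → ℝ} (hx : MemLdown x) (h0 : w 0 = lam)
    (hw : ∀ j, 0 ≤ w j) (hlt : ∀ j, x j < 1 → w (j + 1) = 0)
    (heq : ∀ j, x j = 1 → w j - w (j + 1) = 1 - x (j + 1)) (j : ℕ) :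
    w j = overflow lam x j := by
  have hm : x (mIdx x) < 1 := Nat.sInf_mem (s := {i | x i < 1}) hx.exists_lt_one
  have hone : ∀ k < mIdx x, x k = 1 := fun k hk =>
    le_antisymm (hx.1 k).2 (not_lt.1 (Nat.notMem_of_lt_sInf (s := {i | x i < 1}) hk))
  have hbelow : ∀ k < mIdx x, w k = lam := by
    intro k
    induction k with
    | zero => exact fun _ => h0
    | succ k ih =>
      intro hk
      have h1 := heq k (hone k (by omega))
      rw [hone (k + 1) hk, ih (by omega)] at h1
      linarith
  unfold overflow
  split_ifs with h1 h2 h3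
  · exact hbelow j h1
  · rw [h3, h0]
  · obtain ⟨k, rfl⟩ := Nat.exists_eq_succ_of_ne_zero h3
    have h4 := heq k (hone k (by omega))
    rw [hbelow k (by omega)] at h4
    have h5 := hw (k + 1)
    rw [Nat.succ_eq_add_one, max_eq_left (by linarith)]
    linarith
  · obtain ⟨k, rfl⟩ := Nat.exists_eq_succ_of_ne_zero (n := j) (by omega)
    exact hlt k (((antitone_nat_of_succ_le hx.2.1) (by omega)).trans_lt hm)

theorem integral_pcoef_fixedPoint (hlam : 0 ≤ lam) (hr : MemLdown r) (hg : CoordContinuous g)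
    (hfix : ∀ i t, 0 ≤ t → g i t = picard r lam g i t) (i : ℕ) {T : ℝ} (hT : 0 ≤ T) :
    ∫ s in (0 : ℝ)..T, pcoef lam (fun j => g j s) i
      = push r lam g i T - push r lam g (i + 1) T := by
  have hac : ∀ j, AbsolutelyContinuousOnInterval (push r lam g j) 0 T := by
    intro j
    refine LipschitzOnWith.absolutelyContinuousOnInterval (K := lam.toNNReal)
      (LipschitzOnWith.of_dist_le_mul ?_)
    have key : ∀ s t, 0 ≤ s → s ≤ t →
        dist (push r lam g j s) (push r lam g j t) ≤ lam.toNNReal * dist s t := by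
      intro s t hs hst
      rw [Real.coe_toNNReal _ hlam, Real.dist_eq, Real.dist_eq, abs_sub_comm, abs_sub_comm s,
        abs_of_nonneg (sub_nonneg.2 hst),
        abs_of_nonneg (sub_nonneg.2 (monotoneOn_push hlam hg j hs (hs.trans hst) hst))]
      exact push_sub_le hlam hg j hs hst
    rw [uIcc_of_le hT]
    intro s hs t ht
    rcases le_total s t with hst | hst
    · exact key s t hs.1 hst
    · rw [dist_comm, dist_comm s]
      exact key t s ht.1 hst
  have hint : ∀ j, ∫ s in (0 : ℝ)..T, deriv (push r lam g j) s = push r lam g j T := fun j => by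
    rw [(hac j).integral_deriv_eq_sub, push_at_zero hlam (fun i => (hr.1 i).2) hg, sub_zero]
  rw [← hint i, ← hint (i + 1), ← intervalIntegral.integral_sub (hac i).intervalIntegrable_deriv
    (hac (i + 1)).intervalIntegrable_deriv]
  refine intervalIntegral.integral_congr_ae ?_
  have hdiff : ∀ᵐ t : ℝ, ∀ j, t ∈ uIcc 0 T → DifferentiableAt ℝ (push r lam g j) t :=
    ae_all_iff.2 fun j => (hac j).ae_differentiableAt
  filter_upwards [hdiff] with t hdt ht
  rw [uIoc_of_le hT] at ht
  have ht0 : 0 < t := ht.1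
  have hd : ∀ j, HasDerivAt (push r lam g j) (deriv (push r lam g j) t) t := fun j =>
    (hdt j (by rw [uIcc_of_le hT]; exact ⟨ht0.le, ht.2⟩)).hasDerivAt
  have hnhds : Ici (0 : ℝ) ∈ 𝓝 t := Ici_mem_nhds ht0
  have hgd : ∀ j, HasDerivAt (g j) (-(g j t - g (j + 1) t) + deriv (push r lam g j) t
      - deriv (push r lam g (j + 1)) t) t := by
    intro j
    have h1 : HasDerivAt (fun t => ∫ u in (0 : ℝ)..t, drift g j u) (drift g j t) t :=
      intervalIntegral.integral_hasDerivAt_right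
        (intervalIntegrable_of_continuousOn_Ici (hg.drift j) le_rfl ht0.le)
        ((hg.drift j).stronglyMeasurableAtFilter_nhdsWithin measurableSet_Ici t |>.filter_mono
          (by rw [nhdsWithin_eq_nhds.2 hnhds]))
        ((hg.drift j).continuousAt hnhds)
    rw [drift_fixedPoint hlam hr hg hfix j ht0.le] at h1
    refine (((h1.const_sub (r j)).add (hd j)).sub (hd (j + 1))).congr_of_eventuallyEq ?_
    filter_upwards [hnhds] with u hu
    exact hfix j u hu
  rw [pcoef_eq_overflow_sub]
  have hw := eq_overflow (lam := lam) (memLdown_fixedPoint hlam hr hg hfix ht0.le)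
    (w := fun j => deriv (push r lam g j) t) ?_ ?_ ?_ ?_
  · rw [← hw i, ← hw (i + 1)]
  · have : push r lam g 0 = fun t => lam * t := rfl
    simp only [this]
    simp
  · intro j
    have := (monotoneOn_push (r := r) hlam hg j).derivWithin_nonneg (x := t)
    rwa [derivWithin_of_mem_nhds hnhds] at this
  · intro j hj
    have h1 : ∀ᶠ u in 𝓝 t, g j u < 1 ∧ 0 ≤ u :=
      (((hg j).continuousAt hnhds).eventually_lt_const hj).and hnhds
    obtain ⟨ε, hε, hball⟩ := Metric.eventually_nhds_iff_ball.1 h1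
    have h2 : push r lam g (j + 1) =ᶠ[𝓝 t] fun _ => push r lam g (j + 1) t := by
      filter_upwards [Metric.ball_mem_nhds t hε] with u hu
      have hmem : ∀ {a b}, a ∈ Metric.ball t ε → b ∈ Metric.ball t ε →
          Icc a b ⊆ Metric.ball t ε := fun ha hb =>
        ((convex_ball t ε).ordConnected.out ha hb)
      have htb := Metric.mem_ball_self (x := t) hε
      rcases le_total u t with hut | htu
      · exact (push_succ_eq_of_lt_one hlam hg hfix j (hball u hu).2 hut
          fun v hv => (hball v (hmem hu htb hv)).1).symm
      · exact push_succ_eq_of_lt_one hlam hg hfix j ht0.le htu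
          fun v hv => (hball v (hmem htb hu hv)).1
    rw [h2.deriv_eq, deriv_const]
  · intro j hj
    have hmax : IsLocalMax (g j) t := by
      filter_upwards [hnhds] with u hu
      rw [hj]
      exact fixedPoint_le_one hlam hg hfix j hu
    have h1 := hmax.hasDerivAt_eq_zero (hgd j)
    rw [hj] at h1
    linarith

end FixedPoint

theorem tendsto_zero_of_le_mul_abs_sub {F : ℝ≥0 → ℝ≥0 → ℝ} {L : ℝ} (h0 : ∀ s t, 0 ≤ F s t)
    (h : ∀ s t, F s t ≤ L * |(s : ℝ) - t|) (t₀ : ℝ≥0) :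
    Tendsto (fun t => F t t₀) (𝓝 t₀) (𝓝 0) := by
  refine squeeze_zero (fun t => h0 t t₀) (fun t => h t t₀) ?_
  have : Continuous fun t : ℝ≥0 => L * |(t : ℝ) - t₀| := by fun_prop
  simpa using this.tendsto t₀

/-- Unique solvability of the explicit fluid limit equations
(`g t i` is the paper's `ĝ_{i+1}(t)`). -/
theorem stmt1 (r : ℕ → ℝ) (hr : MemLdown r) (lam : ℝ) (hlam : 0 < lam) :
    ∃! g : ℝ≥0 → ℕ → ℝ,
      (∀ t, MemLdown (g t)) ∧
      (∀ t₀ : ℝ≥0,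
        Tendsto (fun t => ∑' i, |g t i - g t₀ i|) (𝓝 t₀) (𝓝 0)) ∧
      (∀ i : ℕ, ∀ t : ℝ≥0,
        g t i = r i - (∫ s in (0:ℝ)..(t:ℝ), (g s.toNNReal i - g s.toNNReal (i+1)))
          + ∫ s in (0:ℝ)..(t:ℝ), pcoef lam (g s.toNNReal) i) := by
  obtain ⟨G, hG, hfix⟩ := exists_picard_fixedPoint hlam.le fun i => (hr.1 i).2
  have hmem : ∀ t : ℝ≥0, MemLdown fun i => G i t :=
    fun t => memLdown_fixedPoint hlam.le hr hG hfix t.2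
  have hcont : ∀ t₀ : ℝ≥0, Tendsto (fun t : ℝ≥0 => ∑' i, |G i t - G i t₀|) (𝓝 t₀) (𝓝 0) := by
    refine tendsto_zero_of_le_mul_abs_sub (F := fun t t₀ : ℝ≥0 => ∑' i, |G i t - G i t₀|)
      (L := 1 + lam) (fun s t => tsum_nonneg fun i => abs_nonneg _) fun s t => ?_
    rcases le_total s t with hst | hst
    · rw [abs_sub_comm, abs_of_nonneg (sub_nonneg.2 (NNReal.coe_le_coe.2 hst))]
      simp only [abs_sub_comm (G _ (s : ℝ))]
      exact tsum_abs_fixedPoint_sub_le hlam.le hr hG hfix s.2 hst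
    · rw [abs_of_nonneg (sub_nonneg.2 (NNReal.coe_le_coe.2 hst))]
      exact tsum_abs_fixedPoint_sub_le hlam.le hr hG hfix t.2 hst
  have heqn : ∀ i : ℕ, ∀ t : ℝ≥0,
      G i t = r i - (∫ s in (0 : ℝ)..t, (G i s.toNNReal - G (i + 1) s.toNNReal))
        + ∫ s in (0 : ℝ)..t, pcoef lam (fun j => G j s.toNNReal) i := by
    intro i t
    have ht : (0 : ℝ) ≤ t := t.2
    have h1 : ∫ s in (0 : ℝ)..t, (G i s.toNNReal - G (i + 1) s.toNNReal)
        = ∫ s in (0 : ℝ)..t, drift G i s := by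
      refine intervalIntegral.integral_congr fun s hs => ?_
      rw [uIcc_of_le ht] at hs
      simp only [Real.coe_toNNReal s hs.1]
      exact (drift_fixedPoint hlam.le hr hG hfix i hs.1).symm
    have h2 : ∫ s in (0 : ℝ)..t, pcoef lam (fun j => G j s.toNNReal) i
        = ∫ s in (0 : ℝ)..t, pcoef lam (fun j => G j s) i := by
      refine intervalIntegral.integral_congr fun s hs => ?_
      rw [uIcc_of_le ht] at hs
      simp only [Real.coe_toNNReal s hs.1]
    rw [h1, h2, integral_pcoef_fixedPoint hlam.le hr hG hfix i ht, hfix i t ht]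
    simp only [picard, free]
    ring
  exact ⟨fun t i => G i t, ⟨hmem, hcont, heqn⟩, fun g' ⟨hg', hc', heq'⟩ =>
    fluid_unique hlam.le hg' hmem hc' hcont heq' heqn⟩
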